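/- arXiv:2307.11599 — 4 statements merged into one kernel-verified Lean document; each statement's English description precedes it below -/
import Mathlib

section
/- Let X1, X2, X3 be real n×n matrices such that X = [[X1, X3], [X3ᵀ, X2]] is a symmetric positive semidefinite 2n×2n matrix. Then the block matrix [[X1+X2, X3−X3ᵀ], [X3ᵀ−X3, X1+X2]] is symmetric positive semidefinite. -/
open Matrix ComplexOrder

/-- If `X = [[X1, X3], [X3ᵀ, X2]]` is symmetric PSD then
`[[X1+X2, X3-X3ᵀ], [X3ᵀ-X3, X1+X2]]` is symmetric PSD. -/
theorem stmt_3 (n : ℕ) (X1 X2 X3 : Matrix (Fin n) (Fin n) ℝ)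
    (hX : (Matrix.fromBlocks X1 X3 X3ᵀ X2).PosSemidef) :
    (Matrix.fromBlocks (X1 + X2) (X3 - X3ᵀ) (X3ᵀ - X3) (X1 + X2)).PosSemidef := by
  have hJ := hX.add (hX.conjTranspose_mul_mul_same (fromBlocks 0 (-1) 1 0))
  convert hJ using 1
  simp [fromBlocks_transpose, fromBlocks_multiply, fromBlocks_add, sub_eq_add_neg,
    add_comm X1 X2, add_comm X3ᵀ]
end

section
/- (Theorem 2.1, first part.) Let C, A_1, …, A_m be complex Hermitian n×n matrices and b ∈ ℂ^m. Define two sets of real numbers: S_ℝ := { ⟨C_R, H_R⟩ − ⟨C_I, H_I⟩ : H_R, H_I real n×n matrices such that Y = [[H_R, −H_I], [H_I, H_R]] is symmetric PSD and for all k ∈ [m], ⟨(A_k)_R, H_R⟩ − ⟨(A_k)_I, H_I⟩ = Re(b_k) and ⟨(A_k)_R, H_I⟩ + ⟨(A_k)_I, H_R⟩ = Im(b_k) }, and S_ℝ' := { ⟨C_R, X1+X2⟩ − ⟨C_I, X3−X3ᵀ⟩ : X1, X2, X3 real n×n matrices such that X = [[X1, X3], [X3ᵀ, X2]] is symmetric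 PSD and for all k ∈ [m], ⟨(A_k)_R, X1+X2⟩ − ⟨(A_k)_I, X3−X3ᵀ⟩ = Re(b_k) and ⟨(A_k)_R, X3−X3ᵀ⟩ + ⟨(A_k)_I, X1+X2⟩ = Im(b_k) }. Then sup S_ℝ = sup S_ℝ' (as suprema in the extended reals, or equivalently the two sets have the same upper bounds). -/
open Matrix ComplexOrder

theorem Matrix.PosSemidef.fromBlocks_neg_offDiag {n : Type*} [Fintype n] [DecidableEq n]
    {P Q R S : Matrix n n ℝ} (h : (Matrix.fromBlocks P Q R S).PosSemidef) :
    (Matrix.fromBlocks P (-Q) (-R) S).PosSemidef := by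
  have := h.mul_mul_conjTranspose_same (Matrix.fromBlocks 1 0 0 (-1) : Matrix (n ⊕ n) (n ⊕ n) ℝ)
  rw [Matrix.fromBlocks_conjTranspose] at this
  simpa [Matrix.fromBlocks_multiply] using this

theorem Matrix.PosSemidef.fromBlocks_swap {n : Type*} [Fintype n] [DecidableEq n]
    {P Q R S : Matrix n n ℝ} (h : (Matrix.fromBlocks P Q R S).PosSemidef) :
    (Matrix.fromBlocks S R Q P).PosSemidef := by
  simpa using h.submatrix Sum.swap

/-- Theorem 2.1, first part: the real SDP reformulations (PSDP-ℝ) and (PSDP-ℝ')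
of a complex SDP have the same optimal value (suprema in the extended reals). -/
theorem stmt_10 (n m : ℕ) (C : Matrix (Fin n) (Fin n) ℂ)
    (A : Fin m → Matrix (Fin n) (Fin n) ℂ) (b : Fin m → ℂ)
    (hC : C.IsHermitian) (hA : ∀ k, (A k).IsHermitian) :
    sSup (Real.toEReal '' {v : ℝ | ∃ H_R H_I : Matrix (Fin n) (Fin n) ℝ,
        (Matrix.fromBlocks H_R (-H_I) H_I H_R).PosSemidef ∧
        (∀ k, (((A k).map Complex.re)ᵀ * H_R).trace -
                (((A k).map Complex.im)ᵀ * H_I).trace = (b k).re ∧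
              (((A k).map Complex.re)ᵀ * H_I).trace +
                (((A k).map Complex.im)ᵀ * H_R).trace = (b k).im) ∧
        v = ((C.map Complex.re)ᵀ * H_R).trace - ((C.map Complex.im)ᵀ * H_I).trace}) =
    sSup (Real.toEReal '' {v : ℝ | ∃ X1 X2 X3 : Matrix (Fin n) (Fin n) ℝ,
        (Matrix.fromBlocks X1 X3 X3ᵀ X2).PosSemidef ∧
        (∀ k, (((A k).map Complex.re)ᵀ * (X1 + X2)).trace -
                (((A k).map Complex.im)ᵀ * (X3 - X3ᵀ)).trace = (b k).re ∧
              (((A k).map Complex.re)ᵀ * (X3 - X3ᵀ)).trace +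
                (((A k).map Complex.im)ᵀ * (X1 + X2)).trace = (b k).im) ∧
        v = ((C.map Complex.re)ᵀ * (X1 + X2)).trace -
              ((C.map Complex.im)ᵀ * (X3 - X3ᵀ)).trace}) := by
  congr 2
  ext v
  constructor
  · rintro ⟨H, K, hpsd, hcon, rfl⟩
    have hK : Kᵀ = -K := by
      have h := hpsd.isHermitian
      rw [Matrix.isHermitian_fromBlocks_iff] at h
      have h' := h.2.2.1
      simpa [neg_eq_iff_eq_neg] using h'
    have hHsum : (1 / 2 : ℝ) • H + (1 / 2 : ℝ) • H = H := by
      rw [← add_smul]; norm_num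
    have hKsum : (1 / 2 : ℝ) • K - ((1 / 2 : ℝ) • K)ᵀ = K := by
      rw [Matrix.transpose_smul, hK, smul_neg, sub_neg_eq_add, ← add_smul]; norm_num
    refine ⟨(1 / 2 : ℝ) • H, (1 / 2 : ℝ) • H, (1 / 2 : ℝ) • K, ?_, ?_, ?_⟩
    · have h := hpsd.fromBlocks_neg_offDiag.smul (show (0 : ℝ) ≤ 1 / 2 by norm_num)
      rw [Matrix.fromBlocks_smul, neg_neg, ← hK, ← Matrix.transpose_smul] at h
      exact h
    · rwa [hHsum, hKsum]
    · rw [hHsum, hKsum]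
  · rintro ⟨X, Y, Z, hpsd, hcon, rfl⟩
    refine ⟨X + Y, Z - Zᵀ, ?_, hcon, rfl⟩
    have h := hpsd.fromBlocks_neg_offDiag.add hpsd.fromBlocks_swap
    rw [Matrix.fromBlocks_add] at h
    convert h using 2 <;> abel
end

section
/- (Theorem 2.1, consequence.) Let C, A_1, …, A_m be complex Hermitian n×n matrices and b ∈ ℂ^m. Define S_ℂ := { Re(⟨C, H⟩) : H complex Hermitian PSD n×n matrix with ⟨A_k, H⟩ = b_k for all k ∈ [m] } and S_ℝ' := { ⟨C_R, X1+X2⟩ − ⟨C_I, X3−X3ᵀ⟩ : X1, X2, X3 real n×n matrices such that X = [[X1, X3], [X3ᵀ, X2]] is symmetric PSD and for all k ∈ [m], ⟨(A_k)_R, X1+X2⟩ − ⟨(A_k)_I, X3−X3ᵀ⟩ = Re(b_k) and ⟨(A_k)_R, X3−X3ᵀ⟩ + ⟨(A_k)_I, X1+X2⟩ = Im(b_k) }. Then sup S_ℂ = sup S_ℝ' (as suprema in the extended reals). -/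
open Matrix ComplexOrder

/-- The complex matrix `P + i Q` with real part `P` and imaginary part `Q`. -/
def complexOfReIm {m n : Type*} (P Q : Matrix m n ℝ) : Matrix m n ℂ :=
  Matrix.of fun i j => ⟨P i j, Q i j⟩

lemma complexOfReIm_map_re_map_im {m n : Type*} (H : Matrix m n ℂ) :
    complexOfReIm (H.map Complex.re) (H.map Complex.im) = H :=
  rfl

lemma trace_transpose_mul_complexOfReIm {m n : Type*} [Fintype m] [Fintype n]
    (A : Matrix m n ℂ) (P Q : Matrix m n ℝ) :
    (Aᵀ * complexOfReIm P Q).trace =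
      ⟨((A.map Complex.re)ᵀ * P).trace - ((A.map Complex.im)ᵀ * Q).trace,
        ((A.map Complex.re)ᵀ * Q).trace + ((A.map Complex.im)ᵀ * P).trace⟩ := by
  apply Complex.ext <;>
    simp [complexOfReIm, Matrix.trace, Matrix.mul_apply, Finset.sum_sub_distrib,
      Finset.sum_add_distrib]

lemma conjTranspose_complexOfReIm_mul_self {m n : Type*} [Fintype m] (U V : Matrix m n ℝ) :
    (complexOfReIm U V)ᴴ * complexOfReIm U V =
      complexOfReIm (Uᵀ * U + Vᵀ * V) (Uᵀ * V - (Uᵀ * V)ᵀ) := by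
  ext i j
  apply Complex.ext
  · simp [complexOfReIm, Matrix.mul_apply, Finset.sum_add_distrib]
  · simp [complexOfReIm, Matrix.mul_apply, Finset.sum_add_distrib, mul_comm, sub_eq_add_neg,
      add_comm]

lemma conjTranspose_fromCols_mul_self {m n : Type*} [Fintype m] (U V : Matrix m n ℝ) :
    (Matrix.fromCols U V)ᴴ * Matrix.fromCols U V =
      Matrix.fromBlocks (Uᵀ * U) (Uᵀ * V) (Uᵀ * V)ᵀ (Vᵀ * V) := by
  rw [Matrix.conjTranspose_fromCols_eq_fromRows_conjTranspose, Matrix.fromRows_mul_fromCols]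
  simp [Matrix.conjTranspose_eq_transpose_of_trivial]

open scoped MatrixOrder in
lemma Matrix.PosSemidef.exists_eq_conjTranspose_mul_self {𝕜 n : Type*} [RCLike 𝕜] [Fintype n]
    {A : Matrix n n 𝕜} (hA : A.PosSemidef) : ∃ B : Matrix n n 𝕜, A = Bᴴ * B := by
  classical
  exact CStarAlgebra.nonneg_iff_eq_star_mul_self.mp hA.nonneg

/-- A complex matrix is positive semidefinite iff it is `(X₁ + X₂) + i (X₃ - X₃ᵀ)` for some real
positive semidefinite block matrix `[[X₁, X₃], [X₃ᵀ, X₂]]`. -/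
lemma posSemidef_iff_exists_real_blocks {n : Type*} [Fintype n]
    (H : Matrix n n ℂ) :
    H.PosSemidef ↔ ∃ X₁ X₂ X₃ : Matrix n n ℝ,
      (Matrix.fromBlocks X₁ X₃ X₃ᵀ X₂).PosSemidef ∧ H = complexOfReIm (X₁ + X₂) (X₃ - X₃ᵀ) := by
  constructor
  · intro hH
    obtain ⟨B, rfl⟩ := hH.exists_eq_conjTranspose_mul_self
    refine ⟨_, _, _, ?_,
      conjTranspose_complexOfReIm_mul_self (B.map Complex.re) (B.map Complex.im)⟩
    rw [← conjTranspose_fromCols_mul_self]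
    exact Matrix.posSemidef_conjTranspose_mul_self _
  · rintro ⟨X₁, X₂, X₃, hX, rfl⟩
    obtain ⟨W, hW⟩ := hX.exists_eq_conjTranspose_mul_self
    rw [← Matrix.fromCols_toCols W, conjTranspose_fromCols_mul_self,
      Matrix.fromBlocks_inj] at hW
    obtain ⟨rfl, rfl, -, rfl⟩ := hW
    rw [← conjTranspose_complexOfReIm_mul_self]
    exact Matrix.posSemidef_conjTranspose_mul_self _

/-- Theorem 2.1, consequence: the complex SDP (PSDP-ℂ) and the real reformulation
(PSDP-ℝ') have the same optimal value (suprema in the extended reals). -/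
theorem stmt_11 (n m : ℕ) (C : Matrix (Fin n) (Fin n) ℂ)
    (A : Fin m → Matrix (Fin n) (Fin n) ℂ) (b : Fin m → ℂ)
    (hC : C.IsHermitian) (hA : ∀ k, (A k).IsHermitian) :
    sSup (Real.toEReal '' {v : ℝ | ∃ H : Matrix (Fin n) (Fin n) ℂ,
        H.PosSemidef ∧ (∀ k, ((A k)ᵀ * H).trace = b k) ∧
        v = ((Cᵀ * H).trace).re}) =
    sSup (Real.toEReal '' {v : ℝ | ∃ X1 X2 X3 : Matrix (Fin n) (Fin n) ℝ,
        (Matrix.fromBlocks X1 X3 X3ᵀ X2).PosSemidef ∧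
        (∀ k, (((A k).map Complex.re)ᵀ * (X1 + X2)).trace -
                (((A k).map Complex.im)ᵀ * (X3 - X3ᵀ)).trace = (b k).re ∧
              (((A k).map Complex.re)ᵀ * (X3 - X3ᵀ)).trace +
                (((A k).map Complex.im)ᵀ * (X1 + X2)).trace = (b k).im) ∧
        v = ((C.map Complex.re)ᵀ * (X1 + X2)).trace -
              ((C.map Complex.im)ᵀ * (X3 - X3ᵀ)).trace}) := by
  congr 2
  ext v
  constructor
  · rintro ⟨H, hH, hAH, rfl⟩
    obtain ⟨X1, X2, X3, hX, rfl⟩ := (posSemidef_iff_exists_real_blocks H).mp hH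
    simp only [trace_transpose_mul_complexOfReIm, Complex.ext_iff] at hAH ⊢
    exact ⟨X1, X2, X3, hX, hAH, rfl⟩
  · rintro ⟨X1, X2, X3, hX, hAX, rfl⟩
    refine ⟨_, (posSemidef_iff_exists_real_blocks _).mpr ⟨X1, X2, X3, hX, rfl⟩, ?_, ?_⟩
    · simpa only [trace_transpose_mul_complexOfReIm, Complex.ext_iff] using hAX
    · rw [trace_transpose_mul_complexOfReIm]
end

section
/- (Theorem 2.1, second part.) Let C, A_1, …, A_m be complex Hermitian n×n matrices and b ∈ ℂ^m. Suppose X1⋆, X2⋆, X3⋆ are real n×n matrices such that X⋆ = [[X1⋆, X3⋆], [(X3⋆)ᵀ, X2⋆]] is feasible for the real SDP (PSDP-ℝ') (i.e., X⋆ is symmetric PSD and for all k ∈ [m], ⟨(A_k)_R, X1⋆+X2⋆⟩ − ⟨(A_k)_I, X3⋆−(X3⋆)ᵀ⟩ = Re(b_k) and ⟨(A_k)_R, X3⋆−(X3⋆)ᵀ⟩ + ⟨(A_k)_I, X1⋆+X2⋆⟩ = Im(b_k)) and its objective value ⟨C_R, X1⋆+X2⋆⟩ − ⟨C_I, X3⋆−(X3⋆)ᵀ⟩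 is the supremum of objective values over all feasible points of (PSDP-ℝ'). Then H⋆ := (X1⋆+X2⋆) + i·(X3⋆−(X3⋆)ᵀ) is feasible for the complex SDP (PSDP-ℂ) (i.e., H⋆ is Hermitian PSD and ⟨A_k, H⋆⟩ = b_k for all k) and Re(⟨C, H⋆⟩) equals the supremum of Re(⟨C, H⟩) over all Hermitian PSD H with ⟨A_k, H⟩ = b_k for all k; that is, H⋆ is an optimal solution of (PSDP-ℂ). -/
open Matrix ComplexOrder

/-- The real part of the complex trace pairing, in terms of real and imaginary parts. -/
theorem trace_transpose_mul_re {ι : Type*} [Fintype ι] (A H : Matrix ι ι ℂ) :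
    (Aᵀ * H).trace.re =
      ((A.map Complex.re)ᵀ * H.map Complex.re).trace -
        ((A.map Complex.im)ᵀ * H.map Complex.im).trace := by
  simp [Matrix.trace, Matrix.mul_apply, Finset.sum_sub_distrib]

/-- The imaginary part of the complex trace pairing, in terms of real and imaginary parts. -/
theorem trace_transpose_mul_im {ι : Type*} [Fintype ι] (A H : Matrix ι ι ℂ) :
    (Aᵀ * H).trace.im =
      ((A.map Complex.re)ᵀ * H.map Complex.im).trace +
        ((A.map Complex.im)ᵀ * H.map Complex.re).trace := by
  simp [Matrix.trace, Matrix.mul_apply, Finset.sum_add_distrib]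

/-- A real positive semidefinite matrix is positive semidefinite as a complex matrix. -/
theorem posSemidef_map_ofReal {ι : Type*} [Finite ι] {X : Matrix ι ι ℝ}
    (hX : X.PosSemidef) : (X.map Complex.ofReal).PosSemidef := by
  obtain ⟨m, v, rfl⟩ := Matrix.posSemidef_iff_eq_sum_vecMulVec.mp hX
  refine Matrix.posSemidef_iff_eq_sum_vecMulVec.mpr ⟨m, fun k i => (v k i : ℂ), ?_⟩
  ext i j
  simp [Matrix.sum_apply, Matrix.vecMulVec_apply]

/-- Compressing a real positive semidefinite block matrix yields a complex one. -/
theorem posSemidef_complex_of_fromBlocks {ι : Type*} [Fintype ι] [DecidableEq ι]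
    {X1 X2 X3 : Matrix ι ι ℝ} (hX : (Matrix.fromBlocks X1 X3 X3ᵀ X2).PosSemidef) :
    (Matrix.of fun i j => (⟨(X1 + X2) i j, (X3 - X3ᵀ) i j⟩ : ℂ)).PosSemidef := by
  have h := (posSemidef_map_ofReal hX).conjTranspose_mul_mul_same
    (Matrix.fromRows (1 : Matrix ι ι ℂ) (Complex.I • (1 : Matrix ι ι ℂ)))
  convert h using 1
  rw [Matrix.fromBlocks_map, Matrix.conjTranspose_fromRows_eq_fromCols_conjTranspose,
    Matrix.fromCols_mul_fromBlocks, Matrix.fromCols_mul_fromRows]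
  ext i j
  apply Complex.ext
  · simp
  · simp; ring

/-- The symmetrised real block matrix of a complex positive semidefinite matrix is
positive semidefinite. -/
theorem posSemidef_fromBlocks_re_im {ι : Type*} [Fintype ι] {H : Matrix ι ι ℂ}
    (hH : H.PosSemidef) :
    (Matrix.fromBlocks (H.map Complex.re) (H.map Complex.im) (H.map Complex.im)ᵀ
      (H.map Complex.re)).PosSemidef := by
  have hre : (H.map Complex.re)ᵀ = H.map Complex.re := by
    ext i j
    simpa using congrArg Complex.re (hH.isHermitian.apply i j)
  have him : (H.map Complex.im)ᵀ = -H.map Complex.im := by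
    ext i j
    have := congrArg Complex.im (hH.isHermitian.apply i j)
    simp at this ⊢
    linarith
  refine Matrix.PosSemidef.of_dotProduct_mulVec_nonneg ?_ fun v => ?_
  · rw [Matrix.IsHermitian, Matrix.conjTranspose_eq_transpose_of_trivial,
      Matrix.fromBlocks_transpose, hre, Matrix.transpose_transpose]
  · have h := (Complex.le_def.mp (hH.dotProduct_mulVec_nonneg
      fun i => (⟨v (Sum.inl i), -v (Sum.inr i)⟩ : ℂ))).1
    rw [him]
    refine h.trans_eq ?_
    simp only [dotProduct, Matrix.mulVec, Fintype.sum_sum_type, Complex.re_sum,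
      Matrix.fromBlocks_apply₁₁, Matrix.fromBlocks_apply₁₂, Matrix.fromBlocks_apply₂₁,
      Matrix.fromBlocks_apply₂₂, Pi.star_apply, Complex.mul_re, Complex.mul_im, Matrix.map_apply,
      Matrix.neg_apply, star_trivial, Complex.star_def, Complex.conj_re, Complex.conj_im,
      ← Finset.sum_add_distrib, Finset.mul_sum]
    refine Finset.sum_congr rfl fun i _ => Finset.sum_congr rfl fun j _ => ?_
    ring

/-- Theorem 2.1, second part: if `X⋆ = [[X1⋆, X3⋆], [(X3⋆)ᵀ, X2⋆]]` is an optimal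
solution of (PSDP-ℝ'), then `H⋆ := (X1⋆+X2⋆) + i·(X3⋆-(X3⋆)ᵀ)` is an optimal
solution of the complex SDP (PSDP-ℂ). -/
theorem stmt_12 (n m : ℕ) (C : Matrix (Fin n) (Fin n) ℂ)
    (A : Fin m → Matrix (Fin n) (Fin n) ℂ) (b : Fin m → ℂ)
    (hC : C.IsHermitian) (hA : ∀ k, (A k).IsHermitian)
    (X1 X2 X3 : Matrix (Fin n) (Fin n) ℝ)
    (hXpsd : (Matrix.fromBlocks X1 X3 X3ᵀ X2).PosSemidef)
    (hXfeas : ∀ k, (((A k).map Complex.re)ᵀ * (X1 + X2)).trace -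
                     (((A k).map Complex.im)ᵀ * (X3 - X3ᵀ)).trace = (b k).re ∧
                   (((A k).map Complex.re)ᵀ * (X3 - X3ᵀ)).trace +
                     (((A k).map Complex.im)ᵀ * (X1 + X2)).trace = (b k).im)
    (hXopt : ∀ Y1 Y2 Y3 : Matrix (Fin n) (Fin n) ℝ,
        (Matrix.fromBlocks Y1 Y3 Y3ᵀ Y2).PosSemidef →
        (∀ k, (((A k).map Complex.re)ᵀ * (Y1 + Y2)).trace -
                (((A k).map Complex.im)ᵀ * (Y3 - Y3ᵀ)).trace = (b k).re ∧
              (((A k).map Complex.re)ᵀ * (Y3 - Y3ᵀ)).trace +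
                (((A k).map Complex.im)ᵀ * (Y1 + Y2)).trace = (b k).im) →
        ((C.map Complex.re)ᵀ * (Y1 + Y2)).trace -
            ((C.map Complex.im)ᵀ * (Y3 - Y3ᵀ)).trace ≤
          ((C.map Complex.re)ᵀ * (X1 + X2)).trace -
            ((C.map Complex.im)ᵀ * (X3 - X3ᵀ)).trace)
    (Hstar : Matrix (Fin n) (Fin n) ℂ)
    (hHdef : Hstar = Matrix.of fun i j => (⟨(X1 + X2) i j, (X3 - X3ᵀ) i j⟩ : ℂ)) :
    Hstar.PosSemidef ∧ (∀ k, ((A k)ᵀ * Hstar).trace = b k) ∧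
      ∀ H : Matrix (Fin n) (Fin n) ℂ, H.PosSemidef →
        (∀ k, ((A k)ᵀ * H).trace = b k) →
        ((Cᵀ * H).trace).re ≤ ((Cᵀ * Hstar).trace).re := by
  have hre : Hstar.map Complex.re = X1 + X2 := by
    ext i j
    simp [hHdef]
  have him : Hstar.map Complex.im = X3 - X3ᵀ := by
    ext i j
    simp [hHdef]
  refine ⟨hHdef ▸ posSemidef_complex_of_fromBlocks hXpsd, fun k => ?_, fun H hH hfeas => ?_⟩
  · apply Complex.ext
    · rw [trace_transpose_mul_re, hre, him, (hXfeas k).1]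
    · rw [trace_transpose_mul_im, hre, him, (hXfeas k).2]
  · set R := H.map Complex.re with hR
    set S := H.map Complex.im with hS
    have hadd : (1 / 2 : ℝ) • R + (1 / 2 : ℝ) • R = R := by
      rw [← add_smul]
      norm_num
    have hsub : (1 / 2 : ℝ) • S - ((1 / 2 : ℝ) • S)ᵀ = S := by
      ext i j
      have := congrArg Complex.im (hH.isHermitian.apply i j)
      simp [hS] at this ⊢
      linarith
    have hpsd : (Matrix.fromBlocks ((1 / 2 : ℝ) • R) ((1 / 2 : ℝ) • S) ((1 / 2 : ℝ) • S)ᵀ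
        ((1 / 2 : ℝ) • R)).PosSemidef := by
      rw [Matrix.transpose_smul, ← Matrix.fromBlocks_smul]
      exact (posSemidef_fromBlocks_re_im hH).smul (by norm_num)
    have h := hXopt _ _ _ hpsd fun k => by
      rw [hadd, hsub, ← hfeas k, trace_transpose_mul_re, trace_transpose_mul_im]
      exact ⟨rfl, rfl⟩
    rw [hadd, hsub] at h
    rwa [trace_transpose_mul_re, trace_transpose_mul_re, hre, him]
end
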